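/- For every finite simple graph G on n vertices and every t ≥ 1, there exists a linearly coded chunk store of length n+1 achieving the optimum S^c_t(G,n+1) in which every stored chunk is the XOR of at most two user chunks (i.e., |A_j| ≤ 2 for every position j); xoring more than two chunks does not reduce fragmentation. -/

import Mathlib

/-- The uncoded stretch metric `S^u_t(G,m)`. -/
noncomputable def uncodedStretch {V : Type*} (G : SimpleGraph V) (t m : ℕ) : ℝ :=
  sInf { r : ℝ | ∃ s : Fin m → V, Function.Surjective s ∧
    ∀ (u v : V) (p : G.Walk u v), p.IsPath → p.length + 1 ≤ t →
      ∃ a b : ℕ, a ≤ b ∧ b < m ∧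
        (∀ x ∈ p.support, ∃ j : Fin m, a ≤ (j : ℕ) ∧ (j : ℕ) ≤ b ∧ s j = x) ∧
        ((b - a + 1 : ℕ) : ℝ) ≤ r * ((p.length : ℝ) + 1) }

/-- The linear map of a linearly coded chunk store: position `j` stores `⊕_{i ∈ A j} x i`. -/
def linMap {n m : ℕ} (A : Fin m → Finset (Fin n)) (x : Fin n → ZMod 2) : Fin m → ZMod 2 :=
  fun j => ∑ i ∈ A j, x i

/-- `A` is a linearly coded chunk store: the map `(x_1,…,x_n) ↦ (s_1,…,s_m)` is injective. -/
def IsLinStore {n m : ℕ} (A : Fin m → Finset (Fin n)) : Prop :=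
  Function.Injective (linMap A)

/-- Coordinate `i` is recoverable from the interval `[a,b]` of positions of the linearly
coded store `A`. -/
def LinRecovers {n m : ℕ} (A : Fin m → Finset (Fin n)) (a b : ℕ) (i : Fin n) : Prop :=
  ∃ D : Finset (Fin m), (∀ j ∈ D, a ≤ (j : ℕ) ∧ (j : ℕ) ≤ b) ∧
    ∀ i' : Fin n, (∑ j ∈ D, if i' ∈ A j then (1 : ZMod 2) else 0) = if i' = i then 1 else 0

/-- The linearly coded stretch metric `S^c_t(G,m)`. -/
noncomputable def linStretch {n : ℕ} (G : SimpleGraph (Fin n)) (t m : ℕ) : ℝ :=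
  sInf { r : ℝ | ∃ A : Fin m → Finset (Fin n), IsLinStore A ∧
    ∀ (u v : Fin n) (p : G.Walk u v), p.IsPath → p.length + 1 ≤ t →
      ∃ a b : ℕ, a ≤ b ∧ b < m ∧ (∀ i ∈ p.support, LinRecovers A a b i) ∧
        ((b - a + 1 : ℕ) : ℝ) ≤ r * ((p.length : ℝ) + 1) }

namespace ChunkStore

/-- Exchange: rows of an invertible matrix may be replaced by generators of subspaces. -/
lemma exchange {n : ℕ} (S : Fin n → Set (Fin n → ZMod 2))
    (hS : ∀ i, (Pi.single i 1 : Fin n → ZMod 2) ∈ Submodule.span (ZMod 2) (S i)) :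
    ∃ φ : Fin n → (Fin n → ZMod 2), (∀ i, φ i ∈ S i) ∧ LinearIndependent (ZMod 2) φ := by
  classical
  have key : ∀ s : Finset (Fin n), ∃ φ : Fin n → (Fin n → ZMod 2), (∀ i ∈ s, φ i ∈ S i) ∧
      (∀ i, i ∉ s → φ i = Pi.single i 1) ∧
      (Matrix.detRowAlternating (R := ZMod 2) (n := Fin n)) φ ≠ 0 := by
    intro s
    induction s using Finset.induction_on with
    | empty =>
      refine ⟨fun i => Pi.single i 1, by simp, by simp, ?_⟩
      have : (Matrix.of fun i : Fin n => (Pi.single i 1 : Fin n → ZMod 2)) = 1 := by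
        ext i j
        simp [Matrix.one_apply, Pi.single_apply, eq_comm]
      have h2 : (Matrix.detRowAlternating (R := ZMod 2) (n := Fin n))
          (fun i => Pi.single i 1) = Matrix.det (1 : Matrix (Fin n) (Fin n) (ZMod 2)) := by
        rw [← this]; rfl
      rw [h2]; simp
    | insert i s his ih =>
      obtain ⟨φ, h1, h2, h3⟩ := ih
      by_contra hcon
      push Not at hcon
      let L := (Matrix.detRowAlternating (R := ZMod 2) (n := Fin n)).toMultilinearMap.toLinearMap φ i
      have hL : Submodule.span (ZMod 2) (S i) ≤ LinearMap.ker L := by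
        rw [Submodule.span_le]
        intro x hx
        have := hcon (Function.update φ i x) ?_ ?_
        · exact this
        · intro k hk
          by_cases hki : k = i
          · subst hki; simpa using hx
          · rw [Function.update_of_ne hki]
            exact h1 k (by simpa [hki] using hk)
        · intro k hk
          simp only [Finset.mem_insert, not_or] at hk
          rw [Function.update_of_ne hk.1]
          exact h2 k hk.2
      have := hL (hS i)
      rw [LinearMap.mem_ker] at this
      apply h3
      rw [← h2 i his] at this
      simpa [L] using this
  obtain ⟨φ, h1, -, h3⟩ := key Finset.univ
  refine ⟨φ, fun i => h1 i (Finset.mem_univ i), ?_⟩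
  have hu : IsUnit (Matrix.of φ).det := isUnit_iff_ne_zero.mpr h3
  exact Matrix.linearIndependent_rows_of_isUnit ((Matrix.isUnit_iff_isUnit_det _).mpr hu)

/-- Indicator vector of a stored chunk. -/
def vec {n m : ℕ} (A : Fin m → Finset (Fin n)) (j : Fin m) : Fin n → ZMod 2 :=
  fun i => if i ∈ A j then 1 else 0

lemma recovers_iff {n m : ℕ} (A : Fin m → Finset (Fin n)) (a b : ℕ) (i : Fin n) :
    LinRecovers A a b i ↔ ∃ D : Finset (Fin m), (∀ j ∈ D, a ≤ (j : ℕ) ∧ (j : ℕ) ≤ b) ∧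
      ∑ j ∈ D, vec A j = Pi.single i 1 := by
  unfold LinRecovers
  refine exists_congr fun D => and_congr_right fun _ => ?_
  rw [funext_iff]
  refine forall_congr' fun k => ?_
  simp [vec, Finset.sum_apply, Pi.single_apply]

lemma span_top {n m : ℕ} (A : Fin m → Finset (Fin n)) (h : IsLinStore A) :
    Submodule.span (ZMod 2) (Set.range (vec A)) = ⊤ := by
  by_contra hne
  obtain ⟨f, hf0, hf⟩ := Submodule.exists_le_ker_of_lt_top _ (lt_top_iff_ne_top.mpr hne)
  apply hf0
  let x : Fin n → ZMod 2 := fun i => f (Pi.single i 1)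
  have hx : x = 0 := by
    apply h
    funext j
    have hj : f (vec A j) = 0 := hf (Submodule.subset_span ⟨j, rfl⟩)
    rw [LinearMap.pi_apply_eq_sum_univ] at hj
    simp only [linMap, Pi.zero_apply, Finset.sum_const_zero]
    rw [← hj]
    simp only [vec, ite_smul, one_smul, zero_smul, Finset.sum_ite_mem, Finset.univ_inter]
    refine Finset.sum_congr rfl fun i _ => ?_
    simp only [x]
    congr 1
    ext k
    simp [Pi.single_apply, eq_comm]
  refine LinearMap.pi_ext' fun i => ?_
  ext
  simpa using congrFun hx i

lemma z2 (c : ZMod 2) : c = 0 ∨ c = 1 := by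
  revert c; decide

lemma circuit {n : ℕ} (A : Fin (n + 1) → Finset (Fin n)) (h : IsLinStore A) :
    ∃ C : Finset (Fin (n + 1)), ∑ j ∈ C, vec A j = 0 ∧
      (∀ D, ∑ j ∈ D, vec A j = 0 → D = ∅ ∨ D = C) ∧
      ∀ w, ∃ D : Finset (Fin (n + 1)), ∑ j ∈ D, vec A j = w := by
  classical
  let T := Fintype.linearCombination (ZMod 2) (vec A)
  have hT : ∀ f, T f = ∑ j ∈ Finset.univ.filter (fun j => f j = 1), vec A j := by
    intro f
    rw [Fintype.linearCombination_apply, Finset.sum_filter]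
    refine Finset.sum_congr rfl fun j _ => ?_
    rcases z2 (f j) with hj | hj <;> simp [hj]
  have hr : LinearMap.range T = ⊤ := by
    rw [Fintype.range_linearCombination, span_top A h]
  have hk : Module.finrank (ZMod 2) (LinearMap.ker T) = 1 := by
    have := LinearMap.finrank_range_add_finrank_ker T
    rw [hr, finrank_top] at this
    simp at this
    omega
  obtain ⟨⟨c, hc⟩, hc0, hcw⟩ := finrank_eq_one_iff'.mp hk
  refine ⟨Finset.univ.filter (fun j => c j = 1), ?_, ?_, ?_⟩
  · rw [← hT]; exact hc
  · intro D hD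
    let d : Fin (n + 1) → ZMod 2 := fun j => if j ∈ D then 1 else 0
    have hd : Finset.univ.filter (fun j => d j = 1) = D := by ext j; simp [d]
    have hdk : T d = 0 := by rw [hT, hd, hD]
    obtain ⟨r, hr⟩ := hcw ⟨d, hdk⟩
    have hr' : r • c = d := congrArg Subtype.val hr
    rcases z2 r with h0 | h0
    · left
      rw [← hd, ← hr', h0]; simp
    · right
      rw [← hd, ← hr', h0]; simp
  · intro w
    have : w ∈ LinearMap.range T := by rw [hr]; trivial
    obtain ⟨f, hf⟩ := this
    exact ⟨_, by rw [← hT, hf]⟩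

lemma add_self' {n : ℕ} (x : Fin n → ZMod 2) : x + x = 0 := by
  funext i; exact CharTwo.add_self_eq_zero (x i)

lemma sum_symmDiff {n m : ℕ} (f : Fin m → Fin n → ZMod 2) (D C : Finset (Fin m)) :
    ∑ j ∈ symmDiff D C, f j = ∑ j ∈ D, f j + ∑ j ∈ C, f j := by
  have h1 : ∑ j ∈ symmDiff D C, f j = ∑ j ∈ D \ C, f j + ∑ j ∈ C \ D, f j := by
    rw [symmDiff_def, Finset.sup_eq_union, Finset.sum_union disjoint_sdiff_sdiff]
  have h2 := Finset.sum_inter_add_sum_sdiff D C f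
  have h3 := Finset.sum_inter_add_sum_sdiff C D f
  rw [h1, ← h2, ← h3, Finset.inter_comm C D]
  have := add_self' (∑ j ∈ D ∩ C, f j)
  calc _ = (∑ j ∈ D ∩ C, f j + ∑ j ∈ D ∩ C, f j) + (∑ j ∈ D \ C, f j + ∑ j ∈ C \ D, f j) := by
        rw [this, zero_add]
    _ = _ := by abel

/-- Options for placing a coordinate: a plain position, or a cut of the circuit. -/
def optVec {n m : ℕ} (A : Fin m → Finset (Fin n)) (C : Finset (Fin m)) :
    Fin m ⊕ ℕ → Fin n → ZMod 2
  | Sum.inl j => vec A j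
  | Sum.inr g => ∑ c ∈ C.filter (fun c : Fin m => (c : ℕ) < g), vec A c

/-- An option that can be decoded from every interval decoding `i`. -/
def Good {n m : ℕ} (A : Fin m → Finset (Fin n)) (C : Finset (Fin m)) (i : Fin n) :
    Fin m ⊕ ℕ → Prop
  | Sum.inl j => ∀ a b, LinRecovers A a b i → a ≤ (j : ℕ) ∧ (j : ℕ) ≤ b
  | Sum.inr g => ∀ a b, LinRecovers A a b i →
      (∀ c ∈ C, (c : ℕ) < g → a ≤ (c : ℕ) ∧ (c : ℕ) ≤ b) ∨
      (∀ c ∈ C, g ≤ (c : ℕ) → a ≤ (c : ℕ) ∧ (c : ℕ) ≤ b)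

lemma span_nested {n m : ℕ} (A : Fin m → Finset (Fin n)) (C : Finset (Fin m)) (i : Fin n)
    (D D' : Finset (Fin m)) (hD : ∑ j ∈ D, vec A j = Pi.single i 1)
    (hrec : ∀ a b, LinRecovers A a b i → (∀ j ∈ D, a ≤ (j : ℕ) ∧ (j : ℕ) ≤ b) ∨
      (∀ j ∈ D', a ≤ (j : ℕ) ∧ (j : ℕ) ≤ b))
    (hsub : ∀ j ∈ D, ∃ l ∈ D', ∃ r ∈ D', l ≤ j ∧ j ≤ r) :
    (Pi.single i 1 : Fin n → ZMod 2) ∈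
      Submodule.span (ZMod 2) (optVec A C '' {o | Good A C i o}) := by
  rw [← hD]
  refine Submodule.sum_mem _ fun j hj => Submodule.subset_span ⟨Sum.inl j, ?_, rfl⟩
  intro a b hab
  rcases hrec a b hab with h | h
  · exact h j hj
  · obtain ⟨l, hl, r, hr, h1, h2⟩ := hsub j hj
    have := h l hl
    have := h r hr
    have h1' : (l : ℕ) ≤ j := h1
    have h2' : (j : ℕ) ≤ r := h2
    omega

lemma span_crossed {n m : ℕ} (A : Fin m → Finset (Fin n)) (C : Finset (Fin m)) (i : Fin n)
    (D D' : Finset (Fin m)) (hD : ∑ j ∈ D, vec A j = Pi.single i 1)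
    (hC : ∀ j, j ∈ C ↔ ¬ (j ∈ D ↔ j ∈ D'))
    (hrec : ∀ a b, LinRecovers A a b i → (∀ j ∈ D, a ≤ (j : ℕ) ∧ (j : ℕ) ≤ b) ∨
      (∀ j ∈ D', a ≤ (j : ℕ) ∧ (j : ℕ) ≤ b))
    (l' r' : Fin m) (hl' : l' ∈ D') (hr' : r' ∈ D') (hlmin : ∀ j ∈ D', l' ≤ j)
    (hrmax : ∀ j ∈ D', j ≤ r') (hl : ∃ l ∈ D, l < l') (hr : ∀ j ∈ D, j < r') :
    (Pi.single i 1 : Fin n → ZMod 2) ∈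
      Submodule.span (ZMod 2) (optVec A C '' {o | Good A C i o}) := by
  rw [← hD, ← Finset.sum_filter_add_sum_filter_not D (fun j => (j : ℕ) < l')]
  have hfil : D.filter (fun j : Fin m => (j : ℕ) < l') = C.filter (fun j : Fin m => (j : ℕ) < l') := by
    ext j
    simp only [Finset.mem_filter, hC]
    constructor
    · rintro ⟨h1, h2⟩
      refine ⟨fun h => ?_, h2⟩
      have := hlmin j (h.1 h1)
      exact absurd h2 (not_lt.mpr this)
    · rintro ⟨h1, h2⟩
      refine ⟨?_, h2⟩
      have : j ∉ D' := fun h => absurd h2 (not_lt.mpr (hlmin j h))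
      tauto
  refine Submodule.add_mem _ ?_ ?_
  · rw [hfil]
    refine Submodule.subset_span ⟨Sum.inr (l' : ℕ), ?_, rfl⟩
    intro a b hab
    rcases hrec a b hab with h | h
    · left
      intro c hc hcl
      have : c ∈ C.filter (fun j : Fin m => (j : ℕ) < l') := Finset.mem_filter.mpr ⟨hc, hcl⟩
      rw [← hfil] at this
      exact h c (Finset.mem_filter.mp this).1
    · right
      intro c hc hcl
      have h1 := h l' hl'
      have h2 := h r' hr'
      have h3 : c ≤ r' := by
        by_cases hcD : c ∈ D'
        · exact hrmax c hcD
        · have := (hC c).mp hc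
          exact (hr c (by tauto)).le
      have h3' : (c : ℕ) ≤ r' := h3
      omega
  · refine Submodule.sum_mem _ fun j hj => Submodule.subset_span ⟨Sum.inl j, ?_, rfl⟩
    rw [Finset.mem_filter] at hj
    intro a b hab
    rcases hrec a b hab with h | h
    · exact h j hj.1
    · have h1 := h l' hl'
      have h2 := h r' hr'
      have h3 : (j : ℕ) < r' := hr j hj.1
      omega

lemma span_good {n m : ℕ} (A : Fin m → Finset (Fin n)) (C : Finset (Fin m))
    (hC0 : ∑ j ∈ C, vec A j = 0)
    (hC : ∀ D, ∑ j ∈ D, vec A j = 0 → D = ∅ ∨ D = C)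
    (hsurj : ∀ w, ∃ D : Finset (Fin m), ∑ j ∈ D, vec A j = w) (i : Fin n) :
    (Pi.single i 1 : Fin n → ZMod 2) ∈
      Submodule.span (ZMod 2) (optVec A C '' {o | Good A C i o}) := by
  classical
  obtain ⟨D, hD⟩ := hsurj (Pi.single i 1)
  obtain ⟨D', hD'⟩ : ∃ D', D' = symmDiff D C := ⟨_, rfl⟩
  have hDs' : ∑ j ∈ D', vec A j = Pi.single i 1 := by
    rw [hD', sum_symmDiff, hC0, hD, add_zero]
  have hmem : ∀ j, j ∈ C ↔ ¬ (j ∈ D ↔ j ∈ D') := by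
    intro j
    rw [hD', Finset.mem_symmDiff]
    tauto
  have hrec : ∀ a b, LinRecovers A a b i → (∀ j ∈ D, a ≤ (j : ℕ) ∧ (j : ℕ) ≤ b) ∨
      (∀ j ∈ D', a ≤ (j : ℕ) ∧ (j : ℕ) ≤ b) := by
    intro a b hab
    obtain ⟨E, hE, hEs⟩ := (recovers_iff A a b i).mp hab
    have h0 : ∑ j ∈ symmDiff E D, vec A j = 0 := by
      rw [sum_symmDiff, hEs, hD, add_self']
    rcases hC _ h0 with h | h
    · left
      have : E = D := symmDiff_eq_bot.mp h
      rwa [← this]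
    · right
      have : E = D' := by rw [hD', ← h, symmDiff_comm E D, symmDiff_symmDiff_cancel_left]
      rwa [← this]
  have hne : ∀ E : Finset (Fin m), ∑ j ∈ E, vec A j = Pi.single i 1 → E.Nonempty := by
    intro E hE
    rw [Finset.nonempty_iff_ne_empty]
    rintro rfl
    have := congrFun hE i
    simp at this
  have n1 := hne D hD
  have n2 := hne D' hDs'
  have a1 := D.min'_mem n1
  have a2 := D.max'_mem n1
  have a3 := D'.min'_mem n2
  have a4 := D'.max'_mem n2
  have b1 : ∀ j ∈ D, D.min' n1 ≤ j := fun j hj => D.min'_le j hj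
  have b2 : ∀ j ∈ D, j ≤ D.max' n1 := fun j hj => D.le_max' j hj
  have b3 : ∀ j ∈ D', D'.min' n2 ≤ j := fun j hj => D'.min'_le j hj
  have b4 : ∀ j ∈ D', j ≤ D'.max' n2 := fun j hj => D'.le_max' j hj
  generalize D.min' n1 = l at *
  generalize D.max' n1 = r at *
  generalize D'.min' n2 = l' at *
  generalize D'.max' n2 = r' at *
  have hrec' := fun a b h => (hrec a b h).symm
  have hmem' : ∀ j, j ∈ C ↔ ¬ (j ∈ D' ↔ j ∈ D) := fun j => by rw [hmem j]; tauto
  by_cases c1 : l' ≤ l ∧ r ≤ r'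
  · exact span_nested A C i D D' hD hrec fun j hj =>
      ⟨l', a3, r', a4, c1.1.trans (b1 j hj), (b2 j hj).trans c1.2⟩
  by_cases c2 : l ≤ l' ∧ r' ≤ r
  · exact span_nested A C i D' D hDs' hrec' fun j hj =>
      ⟨l, a1, r, a2, c2.1.trans (b3 j hj), (b4 j hj).trans c2.2⟩
  by_cases c3 : l < l'
  · have c4 : r < r' := by
      by_contra h
      exact c2 ⟨c3.le, not_lt.mp h⟩
    exact span_crossed A C i D D' hD hmem hrec l' r' a3 a4 b3 b4 ⟨l, a1, c3⟩
      fun j hj => (b2 j hj).trans_lt c4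
  · have c4 : r' < r := by
      by_contra h
      exact c1 ⟨not_lt.mp c3, not_lt.mp h⟩
    have c5 : l' < l := by
      by_contra h
      exact c2 ⟨not_lt.mp h, c4.le⟩
    exact span_crossed A C i D' D hDs' hmem' hrec' l r a1 a2 b1 b2 ⟨l', a3, c5⟩
      fun j hj => (b4 j hj).trans_lt c4

/-- Position `j` is the first position of `R` on the left of the cut `g`. -/
def AdjL {m : ℕ} (R : Finset (Fin m)) (j : Fin m) (g : ℕ) : Prop :=
  (j : ℕ) < g ∧ ∀ c ∈ R, (c : ℕ) < g → c ≤ j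

/-- Position `j` is the first position of `R` on the right of the cut `g`. -/
def AdjR {m : ℕ} (R : Finset (Fin m)) (j : Fin m) (g : ℕ) : Prop :=
  g ≤ (j : ℕ) ∧ ∀ c ∈ R, g ≤ (c : ℕ) → j ≤ c

open Classical in
/-- The store whose chunks are XORs of at most two user chunks. -/
noncomputable def newStore {n m : ℕ} (o : Fin n → Fin m ⊕ ℕ) (R : Finset (Fin m)) (j : Fin m) :
    Finset (Fin n) :=
  Finset.univ.filter fun i => o i = Sum.inl j ∨
    (j ∈ R ∧ ∃ g, o i = Sum.inr g ∧ (AdjL R j g ∨ AdjR R j g))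

lemma exists_adjL {m : ℕ} (R : Finset (Fin m)) (g : ℕ) (h : ∃ c ∈ R, (c : ℕ) < g) :
    ∃ p ∈ R, AdjL R p g := by
  obtain ⟨c, hc, hcg⟩ := h
  have hn : (R.filter (fun c : Fin m => (c : ℕ) < g)).Nonempty := ⟨c, by simp [hc, hcg]⟩
  have hm := Finset.max'_mem _ hn
  rw [Finset.mem_filter] at hm
  exact ⟨_, hm.1, hm.2, fun d hd hdg => Finset.le_max' _ _ (by simp [hd, hdg])⟩

lemma exists_adjR {m : ℕ} (R : Finset (Fin m)) (g : ℕ) (h : ∃ c ∈ R, g ≤ (c : ℕ)) :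
    ∃ p ∈ R, AdjR R p g := by
  obtain ⟨c, hc, hcg⟩ := h
  have hn : (R.filter (fun c : Fin m => g ≤ (c : ℕ))).Nonempty := ⟨c, by simp [hc, hcg]⟩
  have hm := Finset.min'_mem _ hn
  rw [Finset.mem_filter] at hm
  exact ⟨_, hm.1, hm.2, fun d hd hdg => Finset.min'_le _ _ (by simp [hd, hdg])⟩

lemma newStore_card {n m : ℕ} (o : Fin n → Fin m ⊕ ℕ) (R : Finset (Fin m))
    (hinj : ∀ i i' j, o i = Sum.inl j → o i' = Sum.inl j → i = i')
    (hR : ∀ i j, o i = Sum.inl j → j ∉ R)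
    (hsep : ∀ i i' g g', i ≠ i' → o i = Sum.inr g → o i' = Sum.inr g' → g ≤ g' →
      ∃ c ∈ R, g ≤ (c : ℕ) ∧ (c : ℕ) < g') (j : Fin m) :
    (newStore o R j).card ≤ 2 := by
  classical
  by_cases hj : j ∈ R
  · have hsub : newStore o R j ⊆
        (Finset.univ.filter fun i => ∃ g, o i = Sum.inr g ∧ AdjL R j g) ∪
        (Finset.univ.filter fun i => ∃ g, o i = Sum.inr g ∧ AdjR R j g) := by
      intro i hi
      simp only [newStore, Finset.mem_filter, Finset.mem_univ, true_and] at hi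
      simp only [Finset.mem_union, Finset.mem_filter, Finset.mem_univ, true_and]
      rcases hi with h | ⟨-, g, hg, h | h⟩
      · exact absurd hj (hR i j h)
      · exact Or.inl ⟨g, hg, h⟩
      · exact Or.inr ⟨g, hg, h⟩
    have key : ∀ i i' g g', o i = Sum.inr g → o i' = Sum.inr g' → g ≤ g' →
        (AdjL R j g ∧ AdjL R j g' ∨ AdjR R j g ∧ AdjR R j g') → i = i' := by
      intro i i' g g' h1 h2 hle h
      by_contra hne
      obtain ⟨c, hc, hc1, hc2⟩ := hsep i i' g g' hne h1 h2 hle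
      rcases h with ⟨ha, hb⟩ | ⟨ha, hb⟩
      · have h3 : (c : ℕ) ≤ j := hb.2 c hc hc2
        have := ha.1
        omega
      · have h3 : (j : ℕ) ≤ c := ha.2 c hc hc1
        have := hb.1
        omega
    refine (Finset.card_le_card hsub).trans ((Finset.card_union_le _ _).trans ?_)
    have e1 : (Finset.univ.filter fun i => ∃ g, o i = Sum.inr g ∧ AdjL R j g).card ≤ 1 := by
      rw [Finset.card_le_one]
      intro i hi i' hi'
      simp only [Finset.mem_filter, Finset.mem_univ, true_and] at hi hi'
      obtain ⟨g, h1, h2⟩ := hi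
      obtain ⟨g', h1', h2'⟩ := hi'
      rcases le_total g g' with h | h
      · exact key i i' g g' h1 h1' h (Or.inl ⟨h2, h2'⟩)
      · exact (key i' i g' g h1' h1 h (Or.inl ⟨h2', h2⟩)).symm
    have e2 : (Finset.univ.filter fun i => ∃ g, o i = Sum.inr g ∧ AdjR R j g).card ≤ 1 := by
      rw [Finset.card_le_one]
      intro i hi i' hi'
      simp only [Finset.mem_filter, Finset.mem_univ, true_and] at hi hi'
      obtain ⟨g, h1, h2⟩ := hi
      obtain ⟨g', h1', h2'⟩ := hi'
      rcases le_total g g' with h | h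
      · exact key i i' g g' h1 h1' h (Or.inr ⟨h2, h2'⟩)
      · exact (key i' i g' g h1' h1 h (Or.inr ⟨h2', h2⟩)).symm
    omega
  · have : (newStore o R j).card ≤ 1 := by
      rw [Finset.card_le_one]
      intro i hi i' hi'
      simp only [newStore, Finset.mem_filter, Finset.mem_univ, true_and, hj, false_and,
        or_false] at hi hi'
      exact hinj i i' j hi hi'
    omega

lemma newStore_sum {n m : ℕ} (o : Fin n → Fin m ⊕ ℕ) (R : Finset (Fin m)) (i : Fin n) (g : ℕ)
    (hi : o i = Sum.inr g) (p q : Fin m) (hp : p ∈ R) (hq : q ∈ R) (hpg : AdjL R p g)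
    (hqg : AdjR R q g) (D : Finset (Fin m)) (hD : D ⊆ R) :
    (∑ j ∈ D, if i ∈ newStore o R j then (1 : ZMod 2) else 0) =
      (if p ∈ D then 1 else 0) + (if q ∈ D then 1 else 0) := by
  classical
  have hne : p ≠ q := by
    rintro rfl
    exact absurd hpg.1 (not_lt.mpr hqg.1)
  have h1 : ∀ j ∈ D, (if i ∈ newStore o R j then (1 : ZMod 2) else 0) =
      (if p = j then 1 else 0) + (if q = j then 1 else 0) := by
    intro j hj
    have hiff : i ∈ newStore o R j ↔ p = j ∨ q = j := by
      simp only [newStore, Finset.mem_filter, Finset.mem_univ, true_and, hi, reduceCtorEq,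
        false_or, hD hj, Sum.inr.injEq]
      constructor
      · rintro ⟨g', rfl, h | h⟩
        · exact Or.inl (le_antisymm (h.2 p hp hpg.1) (hpg.2 j (hD hj) h.1))
        · exact Or.inr (le_antisymm (hqg.2 j (hD hj) h.1) (h.2 q hq hqg.1))
      · rintro (rfl | rfl)
        · exact ⟨g, rfl, Or.inl hpg⟩
        · exact ⟨g, rfl, Or.inr hqg⟩
    by_cases hpj : p = j
    · have : q ≠ j := fun h => hne (hpj.trans h.symm)
      simp [hiff, hpj, this]
    · by_cases hqj : q = j <;> simp [hiff, hpj, hqj]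
  rw [Finset.sum_congr rfl h1, Finset.sum_add_distrib, Finset.sum_ite_eq, Finset.sum_ite_eq]

lemma newStore_recovers {n m : ℕ} (o : Fin n → Fin m ⊕ ℕ) (R : Finset (Fin m))
    (hinj : ∀ i i' j, o i = Sum.inl j → o i' = Sum.inl j → i = i')
    (hR : ∀ i j, o i = Sum.inl j → j ∉ R)
    (hL : ∀ i g, o i = Sum.inr g → ∃ c ∈ R, (c : ℕ) < g)
    (hU : ∀ i g, o i = Sum.inr g → ∃ c ∈ R, g ≤ (c : ℕ))
    (hsep : ∀ i i' g g', i ≠ i' → o i = Sum.inr g → o i' = Sum.inr g' → g ≤ g' →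
      ∃ c ∈ R, g ≤ (c : ℕ) ∧ (c : ℕ) < g') (i : Fin n) (a b : ℕ)
    (h : (∃ j, o i = Sum.inl j ∧ a ≤ (j : ℕ) ∧ (j : ℕ) ≤ b) ∨
      (∃ g, o i = Sum.inr g ∧ ((∀ c ∈ R, (c : ℕ) < g → a ≤ (c : ℕ) ∧ (c : ℕ) ≤ b) ∨
        (∀ c ∈ R, g ≤ (c : ℕ) → a ≤ (c : ℕ) ∧ (c : ℕ) ≤ b)))) :
    LinRecovers (newStore o R) a b i := by
  classical
  rcases h with ⟨j, hj, hab⟩ | ⟨g, hg, hab⟩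
  · refine ⟨{j}, by simpa using hab, fun i' => ?_⟩
    have : i' ∈ newStore o R j ↔ i' = i := by
      simp only [newStore, Finset.mem_filter, Finset.mem_univ, true_and, hR i j hj, false_and,
        or_false]
      exact ⟨fun h => hinj i' i j h hj, fun h => h ▸ hj⟩
    rw [Finset.sum_singleton]
    simp only [this]
  · have hplain : ∀ D ⊆ R, ∀ i' j', o i' = Sum.inl j' →
        (∑ j ∈ D, if i' ∈ newStore o R j then (1 : ZMod 2) else 0) = if i' = i then 1 else 0 := by
      intro D hD i' j' hi'
      have hne : i' ≠ i := by rintro rfl; rw [hi'] at hg; cases hg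
      rw [if_neg hne]
      refine Finset.sum_eq_zero fun j hj => if_neg ?_
      simp only [newStore, Finset.mem_filter, Finset.mem_univ, true_and, hi', reduceCtorEq,
        false_and, exists_false, and_false, or_false, Sum.inl.injEq]
      rintro rfl
      exact hR i' _ hi' (hD hj)
    have hpq : ∀ i' g', o i' = Sum.inr g' → ∃ p ∈ R, ∃ q ∈ R, AdjL R p g' ∧ AdjR R q g' ∧
        (i' = i → (p : ℕ) < g ∧ g ≤ (q : ℕ)) ∧
        (i' ≠ i → ((p : ℕ) < g ↔ (q : ℕ) < g)) := by
      intro i' g' hi'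
      obtain ⟨p, hp, hpa⟩ := exists_adjL R g' (hL i' g' hi')
      obtain ⟨q, hq, hqa⟩ := exists_adjR R g' (hU i' g' hi')
      refine ⟨p, hp, q, hq, hpa, hqa, ?_, ?_⟩
      · rintro rfl
        have : g = g' := by rw [hg] at hi'; exact Sum.inr.inj hi'
        subst this
        exact ⟨hpa.1, hqa.1⟩
      · intro hne
        have e1 := hpa.1
        have e2 := hqa.1
        rcases le_total g g' with hle | hle
        · obtain ⟨c, hc, hc1, hc2⟩ := hsep i i' g g' hne.symm hg hi' hle
          have : (c : ℕ) ≤ p := hpa.2 c hc hc2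
          omega
        · obtain ⟨c, hc, hc1, hc2⟩ := hsep i' i g' g hne hi' hg hle
          have : (q : ℕ) ≤ c := hqa.2 c hc hc1
          omega
    have h11 : (1 : ZMod 2) + 1 = 0 := by decide
    rcases hab with hab | hab
    · refine ⟨R.filter (fun c : Fin m => (c : ℕ) < g), ?_, fun i' => ?_⟩
      · intro j hj
        rw [Finset.mem_filter] at hj
        exact hab j hj.1 hj.2
      · rcases ho : o i' with j' | g'
        · exact hplain _ (Finset.filter_subset _ _) i' j' ho
        · obtain ⟨p, hp, q, hq, hpa, hqa, h1, h2⟩ := hpq i' g' ho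
          rw [newStore_sum o R i' g' ho p q hp hq hpa hqa _ (Finset.filter_subset _ _)]
          simp only [Finset.mem_filter, hp, hq, true_and]
          by_cases hii : i' = i
          · obtain ⟨e1, e2⟩ := h1 hii
            simp [hii, e1, not_lt.mpr e2]
          · by_cases e : (p : ℕ) < g
            · simp [hii, e, (h2 hii).mp e, h11]
            · rw [if_neg e, if_neg fun h => e ((h2 hii).mpr h), if_neg hii, add_zero]
    · refine ⟨R.filter (fun c : Fin m => g ≤ (c : ℕ)), ?_, fun i' => ?_⟩
      · intro j hj
        rw [Finset.mem_filter] at hj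
        exact hab j hj.1 hj.2
      · rcases ho : o i' with j' | g'
        · exact hplain _ (Finset.filter_subset _ _) i' j' ho
        · obtain ⟨p, hp, q, hq, hpa, hqa, h1, h2⟩ := hpq i' g' ho
          rw [newStore_sum o R i' g' ho p q hp hq hpa hqa _ (Finset.filter_subset _ _)]
          simp only [Finset.mem_filter, hp, hq, true_and]
          by_cases hii : i' = i
          · obtain ⟨e1, e2⟩ := h1 hii
            simp [hii, e1, e2]
          · have h2' := h2 hii
            by_cases e : g ≤ (p : ℕ)
            · have : g ≤ (q : ℕ) := by omega
              simp [hii, e, this, h11]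
            · have : ¬ g ≤ (q : ℕ) := by omega
              rw [if_neg e, if_neg this, if_neg hii, add_zero]

lemma isLinStore_of_recovers {n m : ℕ} (A : Fin m → Finset (Fin n))
    (h : ∀ i, ∃ a b, LinRecovers A a b i) : IsLinStore A := by
  classical
  intro x y hxy
  have key : ∀ z : Fin n → ZMod 2, ∀ i (D : Finset (Fin m)),
      (∀ i' : Fin n, (∑ j ∈ D, if i' ∈ A j then (1 : ZMod 2) else 0) = if i' = i then 1 else 0) →
      ∑ j ∈ D, linMap A z j = z i := by
    intro z i D hD
    have : ∀ j, linMap A z j = ∑ i', (if i' ∈ A j then (1 : ZMod 2) else 0) * z i' := by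
      intro j
      simp [linMap]
    simp only [this]
    rw [Finset.sum_comm]
    simp only [← Finset.sum_mul, hD]
    simp
  funext i
  obtain ⟨a, b, D, -, hD⟩ := h i
  rw [← key x i D hD, ← key y i D hD, hxy]

lemma main_store {n : ℕ} (A : Fin (n + 1) → Finset (Fin n)) (h : IsLinStore A) :
    ∃ A' : Fin (n + 1) → Finset (Fin n), IsLinStore A' ∧ (∀ j, (A' j).card ≤ 2) ∧
      ∀ a b i, LinRecovers A a b i → LinRecovers A' a b i := by
  classical
  obtain ⟨C, hC0, hC, hsurj⟩ := circuit A h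
  obtain ⟨φ, hφ, hli⟩ := exchange (fun i => optVec A C '' {o | Good A C i o})
    (span_good A C hC0 hC hsurj)
  choose o ho hoφ using hφ
  have hφeq : φ = fun i => optVec A C (o i) := by funext i; exact (hoφ i).symm
  let R : Finset (Fin (n + 1)) := C.filter fun j => ∀ i, o i ≠ Sum.inl j
  -- sums over circuit positions outside R lie in the span of the plain vectors
  have hspan : ∀ (i : Fin n) (g : ℕ), o i = Sum.inr g → ∀ X ⊆ C, (∀ c ∈ X, c ∉ R) →
      ∑ c ∈ X, vec A c ∈ Submodule.span (ZMod 2) (φ '' {i}ᶜ) := by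
    intro i g hig X hX hXR
    refine Submodule.sum_mem _ fun c hc => Submodule.subset_span ?_
    have h1 := hXR c hc
    simp only [R, Finset.mem_filter, hX hc, true_and, not_forall, not_not] at h1
    obtain ⟨k, hk⟩ := h1
    refine ⟨k, ?_, by rw [← hoφ k, hk]; rfl⟩
    rintro rfl
    rw [hk] at hig
    cases hig
  have hnot : ∀ i, φ i ∉ Submodule.span (ZMod 2) (φ '' {i}ᶜ) := fun i =>
    hli.notMem_span_image (by simp)
  have hinr : ∀ i g, o i = Sum.inr g →
      φ i = ∑ c ∈ C.filter (fun c : Fin (n + 1) => (c : ℕ) < g), vec A c := by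
    intro i g hig
    rw [← hoφ i, hig]; rfl
  have hinj : ∀ i i' j, o i = Sum.inl j → o i' = Sum.inl j → i = i' := by
    intro i i' j h1 h2
    apply hli.injective
    rw [← hoφ i, ← hoφ i', h1, h2]
  have hR : ∀ i j, o i = Sum.inl j → j ∉ R := by
    intro i j hij hj
    exact (Finset.mem_filter.mp hj).2 i hij
  have hL : ∀ i g, o i = Sum.inr g → ∃ c ∈ R, (c : ℕ) < g := by
    intro i g hig
    by_contra hcon
    push Not at hcon
    apply hnot i
    rw [hinr i g hig]
    refine hspan i g hig _ (Finset.filter_subset _ _) fun c hc hcR => ?_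
    exact absurd (Finset.mem_filter.mp hc).2 (not_lt.mpr (hcon c hcR))
  have hU : ∀ i g, o i = Sum.inr g → ∃ c ∈ R, g ≤ (c : ℕ) := by
    intro i g hig
    by_contra hcon
    push Not at hcon
    apply hnot i
    rw [hinr i g hig]
    have hs := Finset.sum_filter_add_sum_filter_not C (fun c => (c : ℕ) < g) (vec A)
    rw [hC0] at hs
    rw [eq_neg_of_add_eq_zero_left hs]
    refine Submodule.neg_mem _ (hspan i g hig _ (Finset.filter_subset _ _) fun c hc hcR => ?_)
    exact absurd (hcon c hcR) (Finset.mem_filter.mp hc).2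
  have hsep : ∀ i i' g g', i ≠ i' → o i = Sum.inr g → o i' = Sum.inr g' → g ≤ g' →
      ∃ c ∈ R, g ≤ (c : ℕ) ∧ (c : ℕ) < g' := by
    intro i i' g g' hne hi hi' hle
    by_contra hcon
    push Not at hcon
    apply hnot i'
    rw [hinr i' g' hi', ← Finset.sum_filter_add_sum_filter_not _ (fun c : Fin (n + 1) => (c : ℕ) < g)]
    refine Submodule.add_mem _ ?_ ?_
    · have : (C.filter (fun c : Fin (n + 1) => (c : ℕ) < g')).filter (fun c : Fin (n + 1) => (c : ℕ) < g) =
          C.filter (fun c : Fin (n + 1) => (c : ℕ) < g) := by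
        ext c
        simp only [Finset.mem_filter]
        constructor
        · rintro ⟨⟨h1, h2⟩, h3⟩; exact ⟨h1, h3⟩
        · rintro ⟨h1, h3⟩; exact ⟨⟨h1, by omega⟩, h3⟩
      rw [this, ← hinr i g hi]
      exact Submodule.subset_span ⟨i, hne, rfl⟩
    · refine hspan i' g' hi' _ ((Finset.filter_subset _ _).trans (Finset.filter_subset _ _))
        fun c hc hcR => ?_
      simp only [Finset.mem_filter] at hc
      have := hcon c hcR (not_lt.mp hc.2)
      omega
  have hrec : ∀ a b i, LinRecovers A a b i → LinRecovers (newStore o R) a b i := by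
    intro a b i hab
    refine newStore_recovers o R hinj hR hL hU hsep i a b ?_
    have hgood := ho i
    rcases hoi : o i with j | g
    · left
      rw [hoi] at hgood
      exact ⟨j, rfl, hgood a b hab⟩
    · right
      rw [hoi] at hgood
      refine ⟨g, rfl, (hgood a b hab).imp ?_ ?_⟩
      · exact fun h c hc => h c (Finset.mem_filter.mp hc).1
      · exact fun h c hc => h c (Finset.mem_filter.mp hc).1
  refine ⟨newStore o R, isLinStore_of_recovers _ fun i => ⟨0, n, hrec 0 n i ?_⟩,
    newStore_card o R hinj hR hsep, hrec⟩
  rw [recovers_iff]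
  obtain ⟨D, hD⟩ := hsurj (Pi.single i 1)
  exact ⟨D, fun j _ => ⟨Nat.zero_le _, Nat.lt_succ_iff.mp j.2⟩, hD⟩

/-- The trivial store: the user chunks in order, followed by an empty chunk. -/
lemma exists_store (n : ℕ) : ∃ A : Fin (n + 1) → Finset (Fin n), IsLinStore A ∧
    ∀ i, LinRecovers A 0 n i := by
  classical
  let A : Fin (n + 1) → Finset (Fin n) := fun j => Finset.univ.filter fun i => i.castSucc = j
  have h : ∀ i, LinRecovers A 0 n i := by
    intro i
    refine ⟨{i.castSucc}, fun j _ => ⟨Nat.zero_le _, Nat.lt_succ_iff.mp j.2⟩, fun i' => ?_⟩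
    simp [A]
  exact ⟨A, isLinStore_of_recovers A fun i => ⟨0, n, h i⟩, h⟩

/-- The optimum is attained. -/
lemma attained {n : ℕ} (G : SimpleGraph (Fin n)) (t : ℕ) (ht : 1 ≤ t) :
    ∃ A : Fin (n + 1) → Finset (Fin n), IsLinStore A ∧
      ∀ (u v : Fin n) (p : G.Walk u v), p.IsPath → p.length + 1 ≤ t →
        ∃ a b : ℕ, a ≤ b ∧ b < n + 1 ∧ (∀ i ∈ p.support, LinRecovers A a b i) ∧
          ((b - a + 1 : ℕ) : ℝ) ≤ linStretch G t (n + 1) * ((p.length : ℝ) + 1) := by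
  obtain ⟨A₀, hA₀, hr₀⟩ := exists_store n
  rcases Nat.eq_zero_or_pos n with hn | hn
  · subst hn
    exact ⟨A₀, hA₀, fun u => u.elim0⟩
  let S : Set ℝ := { r : ℝ | ∃ A : Fin (n + 1) → Finset (Fin n), IsLinStore A ∧
    ∀ (u v : Fin n) (p : G.Walk u v), p.IsPath → p.length + 1 ≤ t →
      ∃ a b : ℕ, a ≤ b ∧ b < n + 1 ∧ (∀ i ∈ p.support, LinRecovers A a b i) ∧
        ((b - a + 1 : ℕ) : ℝ) ≤ r * ((p.length : ℝ) + 1) }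
  have hne : S.Nonempty := by
    refine ⟨(n : ℝ) + 1, A₀, hA₀, fun u v p _ _ => ⟨0, n, Nat.zero_le _, Nat.lt_succ_self n,
      fun i _ => hr₀ i, ?_⟩⟩
    push_cast
    have : (0 : ℝ) ≤ p.length := Nat.cast_nonneg _
    have : (0 : ℝ) ≤ n := Nat.cast_nonneg _
    simp
    nlinarith
  have hbdd : BddBelow S := by
    refine ⟨0, ?_⟩
    rintro r ⟨A, -, hA⟩
    obtain ⟨a, b, -, -, -, hab⟩ := hA ⟨0, hn⟩ ⟨0, hn⟩ SimpleGraph.Walk.nil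
      SimpleGraph.Walk.IsPath.nil (by simpa using ht)
    have h0 : (0 : ℝ) ≤ ((b - a + 1 : ℕ) : ℝ) := Nat.cast_nonneg _
    simp at hab
    have h1 : (0 : ℝ) ≤ ((b - a : ℕ) : ℝ) := Nat.cast_nonneg _
    linarith
  have hclosed : IsClosed S := by
    have hS : S = ⋃ A : {A : Fin (n + 1) → Finset (Fin n) // IsLinStore A},
        ⋂ (u : Fin n) (v : Fin n) (p : G.Walk u v) (_ : p.IsPath) (_ : p.length + 1 ≤ t),
        ⋃ ab : {ab : Fin (n + 1) × Fin (n + 1) // (ab.1 : ℕ) ≤ ab.2 ∧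
          ∀ i ∈ p.support, LinRecovers A.1 ab.1 ab.2 i},
        {r : ℝ | (((ab.1.2 : ℕ) - (ab.1.1 : ℕ) + 1 : ℕ) : ℝ) ≤ r * ((p.length : ℝ) + 1)} := by
      ext r
      simp only [S, Set.mem_ofPred_eq, Set.mem_iUnion, Set.mem_iInter]
      constructor
      · rintro ⟨A, hA, h⟩
        refine ⟨⟨A, hA⟩, fun u v p hp hl => ?_⟩
        obtain ⟨a, b, h1, h2, h3, h4⟩ := h u v p hp hl
        exact ⟨⟨(⟨a, by omega⟩, ⟨b, h2⟩), h1, h3⟩, h4⟩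
      · rintro ⟨⟨A, hA⟩, h⟩
        refine ⟨A, hA, fun u v p hp hl => ?_⟩
        obtain ⟨⟨⟨a, b⟩, h1, h3⟩, h4⟩ := h u v p hp hl
        exact ⟨a, b, h1, b.2, h3, h4⟩
    rw [hS]
    refine isClosed_iUnion_of_finite fun A => ?_
    refine isClosed_iInter fun u => isClosed_iInter fun v => isClosed_iInter fun p =>
      isClosed_iInter fun _ => isClosed_iInter fun _ => isClosed_iUnion_of_finite fun ab => ?_
    exact isClosed_le continuous_const (by fun_prop)
  exact hclosed.csInf_mem hne hbdd

end ChunkStore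

/-- For every finite simple graph `G` on `n` vertices and every `t ≥ 1`,
there is a linearly coded chunk store of length `n+1` achieving the optimum `S^c_t(G,n+1)`
in which every stored chunk is the XOR of at most two user chunks. -/
theorem statement_11 {n : ℕ} (G : SimpleGraph (Fin n)) (t : ℕ) (ht : 1 ≤ t) :
    ∃ A : Fin (n + 1) → Finset (Fin n), IsLinStore A ∧ (∀ j, (A j).card ≤ 2) ∧
      ∀ (u v : Fin n) (p : G.Walk u v), p.IsPath → p.length + 1 ≤ t →
        ∃ a b : ℕ, a ≤ b ∧ b < n + 1 ∧ (∀ i ∈ p.support, LinRecovers A a b i) ∧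
          ((b - a + 1 : ℕ) : ℝ) ≤ linStretch G t (n + 1) * ((p.length : ℝ) + 1) := by
  obtain ⟨A, hA, h⟩ := ChunkStore.attained G t ht
  obtain ⟨A', hA', hcard, hrec⟩ := ChunkStore.main_store A hA
  refine ⟨A', hA', hcard, fun u v p hp hl => ?_⟩
  obtain ⟨a, b, h1, h2, h3, h4⟩ := h u v p hp hl
  exact ⟨a, b, h1, h2, fun i hi => hrec a b i (h3 i hi), h4⟩
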